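/- Let V₇ be a 7-dimensional vector space over an algebraically closed field of characteristic zero, S₃ ⊆ ∧²V₇* a nondegenerate net of skew forms (every nonzero element has rank 6), and V₄ ⊆ V₇ a 4-dimensional subspace. Then V₄ is not totally isotropic for all forms in S₃: there exists σ ∈ S₃ nonzero with σ|_{V₄} ≠ 0. -/

import Mathlib

open Module

namespace Segre

open MvPolynomial

variable (k : Type*) [Field k] (m n : ℕ)

/-- The polynomial ring in two groups of variables, of sizes `m + 1` and `n + 1`. -/
abbrev BiPoly : Type _ := MvPolynomial (Fin (m + 1) ⊕ Fin (n + 1)) k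

/-- The map sending the coordinate `x i j` on matrices to the product `s i * q j`. -/
noncomputable def param : MvPolynomial (Fin (m + 1) × Fin (n + 1)) k →ₐ[k] BiPoly k m n :=
  aeval fun p => X (Sum.inl p.1) * X (Sum.inr p.2)

/-- The homogeneous coordinate ring of the Segre variety `ℙᵐ × ℙⁿ`. -/
abbrev CoordRing : Type _ := (param k m n).range

instance : Algebra.FiniteType k (CoordRing k m n) :=
  .of_surjective (param k m n).rangeRestrict (param k m n).rangeRestrict_surjective

instance : IsNoetherianRing (CoordRing k m n) :=
  Algebra.FiniteType.isNoetherianRing k _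

instance : IsJacobsonRing (CoordRing k m n) :=
  isJacobsonRing_of_finiteType (A := k)

variable {m n} in
/-- The class of the coordinate `x i j` in the Segre ring. -/
noncomputable def coord (i : Fin (m + 1)) (j : Fin (n + 1)) : CoordRing k m n :=
  (param k m n).rangeRestrict (X (i, j))

variable {m n} in
lemma coe_coord (i : Fin (m + 1)) (j : Fin (n + 1)) :
    (coord k i j : BiPoly k m n) = X (Sum.inl i) * X (Sum.inr j) :=
  aeval_X (R := k) (fun p : Fin (m + 1) × Fin (n + 1) =>
    (X (Sum.inl p.1) * X (Sum.inr p.2) : BiPoly k m n)) (i, j)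

/-- The order in which the variables are killed in the chain `chainPrime`. -/
def killTime : Fin (m + 1) ⊕ Fin (n + 1) → ℕ :=
  Sum.elim (fun i => if i = Fin.last m then m + n else i)
    (fun j => if j = Fin.last n then m + n else m + j)

lemma killTime_le (v : Fin (m + 1) ⊕ Fin (n + 1)) : killTime m n v ≤ m + n := by
  rcases v with i | j <;> simp only [killTime, Sum.elim_inl, Sum.elim_inr] <;> split_ifs <;> omega

/-- The endomorphism killing the variables whose `killTime` is less than `t`. -/
noncomputable def kill (t : ℕ) : BiPoly k m n →ₐ[k] BiPoly k m n :=
  aeval fun v => if killTime m n v < t then 0 else X v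

lemma kill_X (t : ℕ) (v : Fin (m + 1) ⊕ Fin (n + 1)) :
    kill k m n t (X v) = if killTime m n v < t then 0 else X v := by
  simp [kill]

lemma kill_succ_kill (t : ℕ) (p : BiPoly k m n) :
    kill k m n (t + 1) (kill k m n t p) = kill k m n (t + 1) p := by
  have : (kill k m n (t + 1)).comp (kill k m n t) = kill k m n (t + 1) := by
    ext1 v
    rw [AlgHom.comp_apply, kill_X, kill_X]
    by_cases h : killTime m n v < t
    · simp [h, h.trans (Nat.lt_succ_self t)]
    · rw [if_neg h, kill_X]
  exact DFunLike.congr_fun this p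

/-- A chain of primes in the Segre ring. -/
noncomputable def chainPrime (t : ℕ) : Ideal (CoordRing k m n) :=
  RingHom.ker ((kill k m n t).comp (param k m n).range.val)

instance (t : ℕ) : (chainPrime k m n t).IsPrime := RingHom.ker_isPrime _

variable {k m n} in
lemma mem_chainPrime {t : ℕ} {a : CoordRing k m n} :
    a ∈ chainPrime k m n t ↔ kill k m n t (a : BiPoly k m n) = 0 := Iff.rfl

variable {k m n} in
lemma coord_mem_chainPrime {t : ℕ} {i : Fin (m + 1)} {j : Fin (n + 1)} :
    coord k i j ∈ chainPrime k m n t ↔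
      killTime m n (Sum.inl i) < t ∨ killTime m n (Sum.inr j) < t := by
  rw [mem_chainPrime, coe_coord, map_mul, kill_X, kill_X, mul_eq_zero]
  simp

lemma exists_min_killTime_eq {t : ℕ} (ht : t ≤ m + n) :
    ∃ i j, min (killTime m n (Sum.inl i)) (killTime m n (Sum.inr j)) = t := by
  simp only [killTime, Sum.elim_inl, Sum.elim_inr]
  rcases lt_or_ge t m with h | h
  · refine ⟨⟨t, by omega⟩, Fin.last n, ?_⟩
    simp only [Fin.ext_iff, Fin.val_last]
    split_ifs <;> omega
  · refine ⟨Fin.last m, ⟨t - m, by omega⟩, ?_⟩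
    simp only [Fin.ext_iff, Fin.val_last]
    split_ifs <;> omega

lemma chainPrime_lt_succ {t : ℕ} (ht : t ≤ m + n) :
    chainPrime k m n t < chainPrime k m n (t + 1) := by
  obtain ⟨i, j, hij⟩ := exists_min_killTime_eq m n ht
  refine SetLike.lt_iff_le_and_exists.mpr ⟨fun a ha => ?_, coord k i j, ?_, ?_⟩
  · rw [mem_chainPrime] at ha ⊢
    rw [← kill_succ_kill, ha, map_zero]
  · rw [coord_mem_chainPrime]; omega
  · rw [coord_mem_chainPrime]; omega

lemma le_height_chainPrime {t : ℕ} (ht : t ≤ m + n + 1) :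
    (t : ℕ∞) ≤ (chainPrime k m n t).height := by
  induction t with
  | zero => simp
  | succ t ih =>
    push_cast
    exact (add_le_add_left (ih (by omega)) 1).trans
      (Ideal.height_add_one_le_of_lt_of_isPrime (chainPrime_lt_succ k m n (by omega)))

variable {k m n} in
/-- The kernel of a point at which all coordinates vanish contains the irrelevant ideal. -/
lemma chainPrime_le_ker (ψ : CoordRing k m n →ₐ[k] k) (hψ : ∀ i j, ψ (coord k i j) = 0) :
    chainPrime k m n (m + n + 1) ≤ RingHom.ker ψ := by
  have key : (((Algebra.ofId k (BiPoly k m n)).comp ψ).comp (param k m n).rangeRestrict) =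
      ((kill k m n (m + n + 1)).comp (param k m n).range.val).comp
        (param k m n).rangeRestrict := by
    ext1 ⟨i, j⟩
    change Algebra.ofId k (BiPoly k m n) (ψ (coord k i j)) =
      kill k m n (m + n + 1) (coord k i j : BiPoly k m n)
    rw [hψ, map_zero, eq_comm, ← mem_chainPrime, coord_mem_chainPrime]
    exact .inl (Nat.lt_succ_of_le (killTime_le m n _))
  intro a ha
  obtain ⟨p, rfl⟩ := (param k m n).rangeRestrict_surjective a
  have h := DFunLike.congr_fun key p
  rw [AlgHom.comp_apply, AlgHom.comp_apply, AlgHom.comp_apply] at h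
  rw [RingHom.mem_ker]
  refine (algebraMap k (BiPoly k m n)).injective ?_
  rw [map_zero]
  exact h.trans ha

end Segre

/-- Over an algebraically closed field, a maximal ideal of a finitely generated algebra is the
kernel of a rational point. -/
lemma Ideal.IsMaximal.exists_algHom_ker_eq {k A : Type*} [Field k] [IsAlgClosed k] [CommRing A]
    [Algebra k A] [Algebra.FiniteType k A] (M : Ideal A) [hM : M.IsMaximal] :
    ∃ ψ : A →ₐ[k] k, RingHom.ker ψ = M := by
  let := Ideal.Quotient.field M
  have : Module.Finite k (A ⧸ M) := finite_of_finite_type_of_isJacobsonRing k (A ⧸ M)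
  let e : k ≃ₐ[k] A ⧸ M := AlgEquiv.ofBijective (Algebra.ofId k (A ⧸ M))
    IsAlgClosed.algebraMap_bijective_of_isIntegral
  refine ⟨(e.symm : (A ⧸ M) →ₐ[k] k).comp (Ideal.Quotient.mkₐ k M), ?_⟩
  ext a
  simp [RingHom.mem_ker, Ideal.Quotient.eq_zero_iff_mem]

open Segre in
/-- At most `m + n` bilinear equations have a common nontrivial solution on `ℙᵐ × ℙⁿ`. -/
theorem exists_common_zero_of_bilinear_system {k : Type*} [Field k] [IsAlgClosed k] {m n r : ℕ}
    (hr : r ≤ m + n) (c : Fin r → Fin (m + 1) → Fin (n + 1) → k) :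
    ∃ s : Fin (m + 1) → k, ∃ q : Fin (n + 1) → k, s ≠ 0 ∧ q ≠ 0 ∧
      ∀ l, ∑ i, ∑ j, c l i j * (s i * q j) = 0 := by
  classical
  by_contra! hcon
  let f : Fin r → CoordRing k m n := fun l => ∑ i, ∑ j, c l i j • coord k i j
  let S : Finset (CoordRing k m n) := Finset.univ.image f
  have hmin : chainPrime k m n (m + n + 1) ∈
      (Ideal.span (S : Set (CoordRing k m n))).minimalPrimes := by
    refine ⟨⟨inferInstance, Ideal.span_le.mpr ?_⟩, fun p ⟨hp, hSp⟩ _ => ?_⟩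
    · intro a ha
      obtain ⟨l, -, rfl⟩ := Finset.mem_image.mp (Finset.mem_coe.mp ha)
      refine Submodule.sum_mem _ fun i _ => Submodule.sum_mem _ fun j _ => ?_
      exact Submodule.smul_of_tower_mem _ _
        (coord_mem_chainPrime.mpr (.inl (Nat.lt_succ_of_le (killTime_le m n _))))
    · rw [← (isJacobsonRing_iff_prime_eq.mp inferInstance p hp : p.jacobson = p)]
      refine le_sInf fun M ⟨hpM, hM⟩ => ?_
      obtain ⟨ψ, rfl⟩ := Ideal.IsMaximal.exists_algHom_ker_eq (k := k) M
      refine chainPrime_le_ker ψ fun i j => ?_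
      by_contra hij
      obtain ⟨l, hl⟩ := hcon (fun a => ψ (coord k a j)) (fun b => ψ (coord k i b))
        (fun h => hij (congrFun h i)) (fun h => hij (congrFun h j))
      refine hl ?_
      have hfl : ψ (f l) = 0 :=
        hpM (hSp (Ideal.subset_span (Finset.mem_coe.mpr (Finset.mem_image_of_mem f (by simp)))))
      have hswap (a b) : coord k a j * coord k i b = coord k i j * coord k a b := by
        apply Subtype.ext
        simp only [MulMemClass.coe_mul, coe_coord]
        ring
      calc ∑ a, ∑ b, c l a b * (ψ (coord k a j) * ψ (coord k i b))
          = ψ (coord k i j) * ψ (f l) := by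
            simp only [f, map_sum, map_smul, smul_eq_mul, Finset.mul_sum]
            refine Finset.sum_congr rfl fun a _ => Finset.sum_congr rfl fun b _ => ?_
            rw [← map_mul, hswap, map_mul]
            ring
        _ = 0 := by rw [hfl, mul_zero]
  have hle := (le_height_chainPrime k m n le_rfl).trans
    (Ideal.height_le_card_of_mem_minimalPrimes_span_finset hmin)
  have hcard : S.card ≤ r := Finset.card_image_le.trans (by simp)
  have : m + n + 1 ≤ S.card := by exact_mod_cast hle
  omega

/-- A bilinear map `E × F → G` over an algebraically closed field, with `E` and `F`
nonzero and `dim G + 2 ≤ dim E + dim F`, vanishes on some pair of nonzero vectors. -/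
theorem LinearMap.exists_ne_zero_apply_eq_zero {k E F G : Type*} [Field k] [IsAlgClosed k]
    [AddCommMonoid E] [Module k E] [AddCommMonoid F] [Module k F]
    [AddCommGroup G] [Module k G] [FiniteDimensional k G]
    (hE : 0 < finrank k E) (hF : 0 < finrank k F)
    (h : finrank k G + 2 ≤ finrank k E + finrank k F) (B : E →ₗ[k] F →ₗ[k] G) :
    ∃ x y, x ≠ 0 ∧ y ≠ 0 ∧ B x y = 0 := by
  let : AddCommGroup E := Module.addCommMonoidToAddCommGroup k
  let : AddCommGroup F := Module.addCommMonoidToAddCommGroup k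
  have := FiniteDimensional.of_finrank_pos hE
  have := FiniteDimensional.of_finrank_pos hF
  obtain ⟨m, hm⟩ := Nat.exists_eq_succ_of_ne_zero hE.ne'
  obtain ⟨n, hn⟩ := Nat.exists_eq_succ_of_ne_zero hF.ne'
  let bE := finBasisOfFinrankEq k E hm
  let bF := finBasisOfFinrankEq k F hn
  let bG := finBasis k G
  obtain ⟨s, q, hs, hq, hsq⟩ := exists_common_zero_of_bilinear_system (m := m) (n := n)
    (by omega) fun l i j => bG.repr (B (bE i) (bF j)) l
  refine ⟨bE.equivFun.symm s, bF.equivFun.symm q, bE.equivFun.symm.map_ne_zero_iff.mpr hs,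
    bF.equivFun.symm.map_ne_zero_iff.mpr hq, ?_⟩
  refine bG.ext_elem fun l => ?_
  rw [map_zero, Finsupp.zero_apply, ← hsq l]
  simp only [Basis.equivFun_symm_apply, map_sum, map_smul, LinearMap.sum_apply,
    LinearMap.smul_apply, Finsupp.coe_finsetSum, Finset.sum_apply, Finsupp.smul_apply,
    smul_eq_mul, Finset.mul_sum]
  rw [Finset.sum_comm]
  exact Finset.sum_congr rfl fun i _ => Finset.sum_congr rfl fun j _ => by ring

/-- The rank of a bilinear form vanishing on `U × U` is at most twice the codimension of `U`. -/
lemma LinearMap.finrank_range_add_two_mul_le {k V : Type*} [Field k] [AddCommGroup V] [Module k V]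
    [FiniteDimensional k V] (σ : V →ₗ[k] V →ₗ[k] k) (U : Submodule k V)
    (hU : ∀ u ∈ U, ∀ w ∈ U, σ u w = 0) :
    finrank k (LinearMap.range σ) + 2 * finrank k U ≤ 2 * finrank k V := by
  have hle : U.map σ ≤ U.dualAnnihilator := by
    rintro _ ⟨u, hu, rfl⟩
    exact (Submodule.mem_dualAnnihilator _).mpr (hU u hu)
  have h₁ : finrank k (U.map σ) ≤ finrank k U.dualAnnihilator := Submodule.finrank_mono hle
  have h₂ := Subspace.finrank_add_finrank_dualAnnihilator_eq U
  have h₃ := LinearMap.finrank_range_add_finrank_ker σ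
  have h₄ := LinearMap.finrank_range_add_finrank_ker (σ.domRestrict U)
  have h₅ : finrank k (LinearMap.ker (σ.domRestrict U)) ≤ finrank k (LinearMap.ker σ) := by
    rw [LinearMap.ker_domRestrict]
    rw [← Submodule.finrank_map_subtype_eq U ((LinearMap.ker σ).comap U.subtype)]
    exact Submodule.finrank_mono (Submodule.map_comap_le _ _)
  rw [LinearMap.range_domRestrict] at h₄
  omega

/-- No 4-dimensional subspace is totally isotropic for a nondegenerate net of skew
forms on a 7-dimensional space. -/
theorem no_totally_isotropic_four_space (k : Type) [Field k] [IsAlgClosed k] [CharZero k]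
    (V : Type) [AddCommGroup V] [Module k V] [FiniteDimensional k V]
    (hV : finrank k V = 7)
    (S₃ : Submodule k (V →ₗ[k] V →ₗ[k] k))
    (halt : ∀ σ ∈ S₃, ∀ v, σ v v = 0)
    (hdim : finrank k S₃ = 3)
    (hnd : ∀ σ ∈ S₃, σ ≠ 0 → finrank k (LinearMap.range σ) = 6)
    (V₄ : Submodule k V) (hV₄ : finrank k V₄ = 4) :
    ∃ σ ∈ S₃, σ ≠ 0 ∧ ∃ v ∈ V₄, ∃ w ∈ V₄, σ v w ≠ 0 := by
  by_contra! hcon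
  have hiso : ∀ σ ∈ S₃, ∀ v ∈ V₄, ∀ w ∈ V₄, σ v w = 0 := fun σ hσ v hv w hw => by
    by_cases h : σ = 0
    · simp [h]
    · exact hcon σ hσ h v hv w hw
  obtain ⟨Q, hQ⟩ := V₄.exists_isCompl
  have hQdim : finrank k Q = 3 := by
    have := Submodule.finrank_add_eq_of_isCompl hQ
    omega
  let B : S₃ →ₗ[k] Q →ₗ[k] Dual k V₄ :=
    LinearMap.mk₂ k (fun σ q => (σ.1 q).domRestrict V₄)
      (fun _ _ _ => rfl) (fun _ _ _ => rfl)
      (fun _ _ _ => by ext; simp) (fun _ _ _ => by ext; simp)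
  have hB : finrank k (Dual k V₄) + 2 ≤ finrank k S₃ + finrank k Q := by
    rw [Subspace.dual_finrank_eq]
    omega
  obtain ⟨⟨σ, hσ⟩, q, hσ0, hq0, hσq⟩ := LinearMap.exists_ne_zero_apply_eq_zero
    (by omega) (by omega) hB B
  have hqV (w : V) (hw : w ∈ V₄) : σ q w = 0 := DFunLike.congr_fun hσq (⟨w, hw⟩ : V₄)
  have hVq (w : V) (hw : w ∈ V₄) : σ w q = 0 := by
    have h := LinearMap.IsAlt.neg (halt σ hσ) (q : V) w
    rw [← h, hqV w hw, neg_zero]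
  have hqV₄ : (q : V) ∉ V₄ := fun h =>
    hq0 (Subtype.ext (Submodule.disjoint_def.mp hQ.disjoint _ h q.2))
  have hU : ∀ u ∈ V₄ ⊔ k ∙ (q : V), ∀ w ∈ V₄ ⊔ k ∙ (q : V), σ u w = 0 := by
    intro u hu w hw
    obtain ⟨u', hu', _, ha, rfl⟩ := Submodule.mem_sup.mp hu
    obtain ⟨a, rfl⟩ := Submodule.mem_span_singleton.mp ha
    obtain ⟨w', hw', _, hb, rfl⟩ := Submodule.mem_sup.mp hw
    obtain ⟨b, rfl⟩ := Submodule.mem_span_singleton.mp hb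
    simp [hiso σ hσ u' hu' w' hw', hqV w' hw', hVq u' hu', halt σ hσ]
  have hlt := Submodule.finrank_lt_finrank_of_lt (SetLike.lt_iff_le_and_exists.mpr
    ⟨le_sup_left, (q : V), Submodule.mem_sup_right (Submodule.mem_span_singleton_self _), hqV₄⟩ :
      V₄ < V₄ ⊔ k ∙ (q : V))
  have hrank := hnd σ hσ fun h => hσ0 (Subtype.ext h)
  have := LinearMap.finrank_range_add_two_mul_le σ _ hU
  omega
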